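/- Let H ∈ (0,1), define a(x) = ∫₀^∞ F_H(v)·cos(xv) dv and b(x) = ∫₀^∞ F_H(v)·(1 − e^{−2Hv})·sin(xv) dv, and let θ ∈ ℝ satisfy √|θ| < (Γ(2H)/Γ(H)²)·((1 − H)/(4H))·sin(πH)·tanh(πH). Then for every x ∈ ℝ: a(x) > (√|θ|/2)·|b(x)|. -/

import Mathlib

open Real MeasureTheory

/-- `F_H(v) = 2 cosh(Hv) - |2 sinh(v/2)|^{2H}`. -/
noncomputable def Ffun (H v : ℝ) : ℝ :=
  2 * Real.cosh (H * v) - |2 * Real.sinh (v / 2)| ^ (2 * H)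

theorem integrableOn_exp_neg_mul_mul {l : ℝ} (hl : 0 < l) {φ : ℝ → ℝ} (hφ : Continuous φ)
    (hb : ∀ v ∈ Set.Ioi (0 : ℝ), |φ v| ≤ 1) :
    IntegrableOn (fun v => exp (-(l * v)) * φ v) (Set.Ioi 0) := by
  have h : IntegrableOn (fun v => exp (-(l * v))) (Set.Ioi 0) := by
    simpa using integrableOn_exp_mul_Ioi (neg_lt_zero.2 hl) 0
  refine h.mono' (by fun_prop) ?_
  filter_upwards [ae_restrict_mem measurableSet_Ioi] with v hv
  rw [norm_mul, norm_eq_abs, norm_eq_abs, abs_of_pos (exp_pos _)]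
  exact mul_le_of_le_one_right (exp_pos _).le (hb v hv)

theorem integral_norm_exp_neg_mul_mul_le {l : ℝ} (hl : 0 < l) {φ : ℝ → ℝ} (hφ : Continuous φ)
    (hb : ∀ v ∈ Set.Ioi (0 : ℝ), |φ v| ≤ 1) :
    ∫ v in Set.Ioi (0 : ℝ), ‖exp (-(l * v)) * φ v‖ ≤ l⁻¹ := by
  have h : IntegrableOn (fun v => exp (-(l * v))) (Set.Ioi 0) := by
    simpa using integrableOn_exp_mul_Ioi (neg_lt_zero.2 hl) 0
  calc _ ≤ ∫ v in Set.Ioi (0 : ℝ), exp (-(l * v)) := by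
        refine setIntegral_mono_on (integrableOn_exp_neg_mul_mul hl hφ hb).norm h
          measurableSet_Ioi fun v hv => ?_
        rw [norm_mul, norm_eq_abs, norm_eq_abs, abs_of_pos (exp_pos _)]
        exact mul_le_of_le_one_right (exp_pos _).le (hb v hv)
    _ = l⁻¹ := by
        have := integral_exp_mul_Ioi (neg_lt_zero.2 hl) 0
        simpa [neg_div] using this

/-- Termwise integration of a mixture of exponentials against a bounded function. -/
theorem hasSum_integral_exp_mixture {c l : ℕ → ℝ} {δ : ℝ} (hδ : 0 < δ) (hl : ∀ k, δ ≤ l k)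
    (hc : Summable fun k => |c k|) {f φ : ℝ → ℝ}
    (hf : ∀ v ∈ Set.Ioi (0 : ℝ), HasSum (fun k => c k * exp (-(l k * v))) (f v))
    (hφ : Continuous φ) (hb : ∀ v ∈ Set.Ioi (0 : ℝ), |φ v| ≤ 1) :
    HasSum (fun k => c k * ∫ v in Set.Ioi (0 : ℝ), exp (-(l k * v)) * φ v)
      (∫ v in Set.Ioi (0 : ℝ), f v * φ v) := by
  have hpos : ∀ k, 0 < l k := fun k => hδ.trans_le (hl k)
  have key := hasSum_integral_of_summable_integral_norm
    (μ := volume.restrict (Set.Ioi (0 : ℝ)))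
    (F := fun k v => c k * (exp (-(l k * v)) * φ v))
    (fun k => (integrableOn_exp_neg_mul_mul (hpos k) hφ hb).const_mul (c k)) (by
      refine Summable.of_nonneg_of_le (fun k => integral_nonneg fun v => norm_nonneg _)
        (fun k => ?_) (hc.mul_right δ⁻¹)
      simp only [norm_mul (c k), norm_eq_abs (c k), integral_const_mul]
      refine mul_le_mul_of_nonneg_left ?_ (abs_nonneg _)
      exact (integral_norm_exp_neg_mul_mul_le (hpos k) hφ hb).trans
        (inv_anti₀ hδ (hl k)))
  simp only [integral_const_mul] at key
  have hsum : ∫ v in Set.Ioi (0 : ℝ), f v * φ v =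
      ∫ v in Set.Ioi (0 : ℝ), ∑' k, c k * (exp (-(l k * v)) * φ v) := by
    refine setIntegral_congr_fun measurableSet_Ioi fun v hv => ?_
    simp only [← mul_assoc]
    exact ((hf v hv).mul_right (φ v)).tsum_eq.symm
  rwa [hsum]

theorem integral_exp_neg_mul_mul_cos_sin {l : ℝ} (hl : 0 < l) (x : ℝ) :
    (∫ v in Set.Ioi (0 : ℝ), exp (-(l * v)) * cos (x * v)) = l / (l ^ 2 + x ^ 2) ∧
    (∫ v in Set.Ioi (0 : ℝ), exp (-(l * v)) * sin (x * v)) = x / (l ^ 2 + x ^ 2) := by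
  set z : ℂ := ⟨-l, x⟩ with hz
  have hre : z.re < 0 := by simpa [hz] using hl
  have hint := integrableOn_exp_mul_complex_Ioi hre 0
  have hval := integral_exp_mul_complex_Ioi hre 0
  have hn : Complex.normSq z = l ^ 2 + x ^ 2 := by simp [hz, Complex.normSq_apply]; ring
  have h1 := integral_re hint
  have h2 := integral_im hint
  rw [hval] at h1 h2
  constructor
  · convert h1 using 1
    · refine integral_congr_ae (.of_forall fun v => ?_)
      simp [Complex.exp_re, hz]
    · simp [hz, neg_div, pow_two]
  · convert h2 using 1
    · refine integral_congr_ae (.of_forall fun v => ?_)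
      simp [Complex.exp_im, hz]
    · simp [Complex.inv_im, hn, neg_div]; simp [hz]

theorem integral_exp_neg_mul_mul_one_sub_exp_mul_sin {l m : ℝ} (hl : 0 < l) (hm : 0 ≤ m) (x : ℝ) :
    ∫ v in Set.Ioi (0 : ℝ), exp (-(l * v)) * ((1 - exp (-(m * v))) * sin (x * v)) =
      x / (l ^ 2 + x ^ 2) - x / ((l + m) ^ 2 + x ^ 2) := by
  have hlm : 0 < l + m := by linarith
  rw [← (integral_exp_neg_mul_mul_cos_sin hl x).2, ← (integral_exp_neg_mul_mul_cos_sin hlm x).2,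
    ← integral_sub
      (integrableOn_exp_neg_mul_mul hl (by fun_prop) fun v _ => abs_sin_le_one _)
      (integrableOn_exp_neg_mul_mul hlm (by fun_prop) fun v _ => abs_sin_le_one _)]
  refine integral_congr_ae (.of_forall fun v => ?_)
  have : exp (-((l + m) * v)) = exp (-(l * v)) * exp (-(m * v)) := by rw [← exp_add]; ring_nf
  simp only [this]
  ring

/-- Coefficients of the expansion of `F_H` as a mixture of decaying exponentials. -/
noncomputable def expCoeff (H : ℝ) : ℕ → ℝ
  | 0 => 1
  | 1 => 2 * H
  | k + 2 => expCoeff H (k + 1) * ((k + 1 - 2 * H) / (k + 2))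

/-- Decay rates of the expansion of `F_H` as a mixture of decaying exponentials. -/
def expRate (H : ℝ) : ℕ → ℝ
  | 0 => H
  | k + 1 => k + 1 - H

theorem expCoeff_zero (H : ℝ) : expCoeff H 0 = 1 := rfl

theorem expCoeff_one (H : ℝ) : expCoeff H 1 = 2 * H := rfl

theorem expRate_zero (H : ℝ) : expRate H 0 = H := rfl

theorem expRate_one (H : ℝ) : expRate H 1 = 1 - H := by simp [expRate]

theorem choose_succ_eq (a : ℝ) (n : ℕ) :
    Ring.choose a (n + 1) = Ring.choose a n * ((a - n) / (n + 1)) := by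
  rw [Ring.choose_eq_smul, Ring.choose_eq_smul, descPochhammer_succ_right,
    Polynomial.smeval_mul, Nat.factorial_succ]
  have : ((n.factorial : ℕ) : ℝ) ≠ 0 := by exact_mod_cast n.factorial_ne_zero
  simp only [smul_eq_mul, Polynomial.smeval_sub, Polynomial.smeval_X, pow_one,
    Polynomial.smeval_natCast, pow_zero, nsmul_eq_mul, mul_one, Nat.cast_mul, Nat.cast_add,
    Nat.cast_one]
  field_simp

theorem expCoeff_succ_eq_choose (H : ℝ) (k : ℕ) :
    expCoeff H (k + 1) = (-1) ^ k * Ring.choose (2 * H) (k + 1) := by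
  induction k with
  | zero => simp [expCoeff]
  | succ k ih =>
    rw [expCoeff, ih, choose_succ_eq _ (k + 1), pow_succ]
    push_cast
    ring

theorem hasSum_one_sub_rpow (a : ℝ) {z : ℝ} (hz0 : 0 ≤ z) (hz1 : z < 1) :
    HasSum (fun k => Ring.choose a k * (-z) ^ k) ((1 - z) ^ a) := by
  have h := (one_add_rpow_hasFPowerSeriesOnBall_zero (a := a)).hasSum (y := -z)
    (by simp [abs_of_nonneg hz0, hz1, enorm_eq_nnnorm, ← NNReal.coe_lt_coe])
  simp only [zero_add, binomialSeries_apply, List.ofFn_const,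
    List.prod_replicate, smul_eq_mul] at h
  rwa [← sub_eq_add_neg] at h

theorem hasSum_Ffun (H : ℝ) {v : ℝ} (hv : 0 < v) :
    HasSum (fun k => expCoeff H k * exp (-(expRate H k * v))) (Ffun H v) := by
  have hlt : exp (-v) < 1 := exp_lt_one_iff.2 (neg_lt_zero.2 hv)
  have h := hasSum_one_sub_rpow (2 * H) (exp_pos (-v)).le hlt
  have h1 := ((hasSum_nat_add_iff' 1).2 h).mul_left (-exp (H * v))
  have e1 : ∀ k : ℕ, expCoeff H (k + 1) * exp (-(expRate H (k + 1) * v)) =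
      -exp (H * v) * (Ring.choose (2 * H) (k + 1) * (-exp (-v)) ^ (k + 1)) := fun k => by
    have : exp (-(expRate H (k + 1) * v)) = exp (H * v) * exp (-v) ^ (k + 1) := by
      rw [← exp_nat_mul, ← exp_add, expRate]; push_cast; ring_nf
    rw [expCoeff_succ_eq_choose, this, neg_pow (exp (-v)), pow_succ (-1 : ℝ)]
    ring
  have hs : 0 < 2 * sinh (v / 2) := by
    have := sinh_pos_iff.2 (half_pos hv); linarith
  have hfac : 2 * sinh (v / 2) = exp (v / 2) * (1 - exp (-v)) := by
    rw [sinh_eq, mul_sub, ← exp_add]; ring_nf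
  have h2 : |2 * sinh (v / 2)| ^ (2 * H) = exp (H * v) * (1 - exp (-v)) ^ (2 * H) := by
    rw [abs_of_pos hs, hfac, mul_rpow (exp_pos _).le (by linarith), ← exp_mul]
    ring_nf
  have e2 : Ffun H v - ∑ k ∈ Finset.range 1, expCoeff H k * exp (-(expRate H k * v)) =
      -exp (H * v) * ((1 - exp (-v)) ^ (2 * H) -
        ∑ k ∈ Finset.range 1, Ring.choose (2 * H) k * (-exp (-v)) ^ k) := by
    simp only [Ffun, h2, cosh_eq, Finset.sum_range_one, expCoeff, expRate, Ring.choose_zero_right,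
      pow_zero]
    ring
  rw [← hasSum_nat_add_iff' 1, e2]
  simpa only [e1] using h1

theorem expCoeff_add_two_mul (H : ℝ) (k : ℕ) :
    (k + 2) * expCoeff H (k + 2) = (k + 1 - 2 * H) * expCoeff H (k + 1) := by
  rw [expCoeff]
  field_simp

theorem sum_expCoeff_succ (H : ℝ) (n : ℕ) :
    2 * H * ∑ i ∈ Finset.range n, expCoeff H (i + 1) =
      2 * H - (n + 1) * expCoeff H (n + 1) := by
  induction n with
  | zero => simp [expCoeff]
  | succ n ih =>
    have := expCoeff_add_two_mul H n
    rw [Finset.sum_range_succ, mul_add, ih]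
    push_cast
    linear_combination this

theorem sum_mul_expCoeff_add_two (H : ℝ) (n : ℕ) :
    (2 * H - 1) * ∑ i ∈ Finset.range n, (i + 2) * -expCoeff H (i + 2) =
      2 * H * (2 * H - 1) - (n + 2) * (n + 1) * -expCoeff H (n + 2) := by
  induction n with
  | zero => simp [expCoeff]; ring
  | succ n ih =>
    have := expCoeff_add_two_mul H (n + 1)
    rw [Finset.sum_range_succ, mul_add, ih]
    push_cast at this ⊢
    linear_combination (-(n : ℝ) - 2) * this

theorem expCoeff_nonneg {H : ℝ} (h0 : 0 < H) (h1 : H ≤ 1 / 2) (k : ℕ) : 0 ≤ expCoeff H k := by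
  rcases k with _ | k
  · simp [expCoeff]
  induction k with
  | zero => simp [expCoeff, h0.le]
  | succ k ih =>
    rw [expCoeff]
    have : (0 : ℝ) ≤ k := k.cast_nonneg
    exact mul_nonneg ih (div_nonneg (by linarith) (by linarith))

theorem expCoeff_add_two_nonpos {H : ℝ} (h0 : 1 / 2 < H) (h1 : H < 1) (k : ℕ) :
    expCoeff H (k + 2) ≤ 0 := by
  induction k with
  | zero =>
    simp only [expCoeff, CharP.cast_eq_zero]
    exact mul_nonpos_of_nonneg_of_nonpos (by linarith) (by linarith)
  | succ k ih =>
    rw [expCoeff]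
    have : (0 : ℝ) ≤ k := k.cast_nonneg
    push_cast
    exact mul_nonpos_of_nonpos_of_nonneg ih (div_nonneg (by linarith) (by linarith))

theorem summable_abs_expCoeff {H : ℝ} (hH : H ∈ Set.Ioo (0 : ℝ) 1) :
    Summable fun k => |expCoeff H k| := by
  obtain ⟨h0, h1⟩ := hH
  rcases le_or_gt H (1 / 2) with h | h
  · rw [← summable_nat_add_iff 1]
    refine summable_of_sum_range_le (c := 1) (fun _ => abs_nonneg _) fun n => ?_
    simp only [abs_of_nonneg (expCoeff_nonneg h0 h _)]
    have := sum_expCoeff_succ H n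
    have h2 : 0 ≤ (n + 1) * expCoeff H (n + 1) :=
      mul_nonneg (by positivity) (expCoeff_nonneg h0 h _)
    nlinarith
  · rw [← summable_nat_add_iff 2]
    refine summable_of_sum_range_le (c := 2 * H - 1) (fun _ => abs_nonneg _) fun n => ?_
    simp only [abs_of_nonpos (expCoeff_add_two_nonpos h h1 _), Finset.sum_neg_distrib]
    have := sum_expCoeff_succ H (n + 1)
    rw [Finset.sum_range_succ'] at this
    have h2 : ((n + 1 : ℕ) + 1) * expCoeff H (n + 1 + 1) ≤ 0 :=
      mul_nonpos_of_nonneg_of_nonpos (by positivity) (expCoeff_add_two_nonpos h h1 _)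
    simp only [expCoeff] at this h2 ⊢
    nlinarith

theorem min_le_expRate (H : ℝ) (k : ℕ) : min H (1 - H) ≤ expRate H k := by
  rcases k with _ | k
  · exact min_le_left _ _
  · refine (min_le_right _ _).trans ?_
    have : (0 : ℝ) ≤ k := k.cast_nonneg
    simp only [expRate]
    linarith

theorem hasSum_cos_transform {H : ℝ} (hH : H ∈ Set.Ioo (0 : ℝ) 1) (x : ℝ) :
    HasSum (fun k => expCoeff H k * (expRate H k / (expRate H k ^ 2 + x ^ 2)))
      (∫ v in Set.Ioi (0 : ℝ), Ffun H v * cos (x * v)) := by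
  have hδ : 0 < min H (1 - H) := lt_min hH.1 (sub_pos.2 hH.2)
  have h := hasSum_integral_exp_mixture hδ (min_le_expRate H) (summable_abs_expCoeff hH)
    (fun v hv => hasSum_Ffun H hv) (φ := fun v => cos (x * v)) (by fun_prop)
    fun v _ => abs_cos_le_one _
  simpa only [(integral_exp_neg_mul_mul_cos_sin (hδ.trans_le (min_le_expRate H _)) x).1] using h

theorem hasSum_sin_transform {H : ℝ} (hH : H ∈ Set.Ioo (0 : ℝ) 1) (x : ℝ) :
    HasSum (fun k => expCoeff H k *
        (x / (expRate H k ^ 2 + x ^ 2) - x / ((expRate H k + 2 * H) ^ 2 + x ^ 2)))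
      (∫ v in Set.Ioi (0 : ℝ), Ffun H v * (1 - exp (-(2 * H * v))) * sin (x * v)) := by
  have hδ : 0 < min H (1 - H) := lt_min hH.1 (sub_pos.2 hH.2)
  have h := hasSum_integral_exp_mixture hδ (min_le_expRate H) (summable_abs_expCoeff hH)
    (fun v hv => hasSum_Ffun H hv) (φ := fun v => (1 - exp (-(2 * H * v))) * sin (x * v))
    (by fun_prop) fun v hv => by
      have h1 : exp (-(2 * H * v)) ≤ 1 :=
        exp_le_one_iff.2 (neg_nonpos.2 (mul_nonneg (by linarith [hH.1]) (le_of_lt hv)))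
      rw [abs_mul, abs_of_nonneg (by linarith)]
      exact mul_le_one₀ (by linarith [exp_pos (-(2 * H * v))]) (abs_nonneg _) (abs_sin_le_one _)
  simpa only [mul_assoc (Ffun H _), integral_exp_neg_mul_mul_one_sub_exp_mul_sin
    (hδ.trans_le (min_le_expRate H _)) (mul_nonneg zero_le_two hH.1.le)] using h

theorem le_expRate {H : ℝ} (h : H ≤ 1 / 2) (k : ℕ) : H ≤ expRate H k := by
  have := min_le_expRate H k
  rwa [min_eq_left (by linarith)] at this

/-- The comparison of the two transforms when all the mixture weights are nonnegative. -/
theorem transform_comparison_of_le_half {H x A B : ℝ} (h0 : 0 < H) (h1 : H ≤ 1 / 2) (hx : 0 ≤ x)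
    (hA : HasSum (fun k => expCoeff H k * (expRate H k / (expRate H k ^ 2 + x ^ 2))) A)
    (hB : HasSum (fun k => expCoeff H k *
      (x / (expRate H k ^ 2 + x ^ 2) - x / ((expRate H k + 2 * H) ^ 2 + x ^ 2))) B) :
    0 < A ∧ |B| ≤ 4 / 3 * A := by
  have hr : ∀ k, 0 < expRate H k := fun k => h0.trans_le (le_expRate h1 k)
  have hdiff : ∀ l, H ≤ l → x / (l ^ 2 + x ^ 2) - x / ((l + 2 * H) ^ 2 + x ^ 2) =
      4 * H * (l + H) * x / ((l ^ 2 + x ^ 2) * ((l + 2 * H) ^ 2 + x ^ 2)) := fun l hl => by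
    have : 0 < l := h0.trans_le hl
    have h2 : 0 < l ^ 2 + x ^ 2 := by positivity
    have h3 : 0 < (l + 2 * H) ^ 2 + x ^ 2 := by positivity
    field_simp
    ring
  have hle : ∀ l, H ≤ l → x / (l ^ 2 + x ^ 2) - x / ((l + 2 * H) ^ 2 + x ^ 2) ≤
      4 / 3 * (l / (l ^ 2 + x ^ 2)) := fun l hl => by
    have : 0 < l := h0.trans_le hl
    have h2 : 0 < l ^ 2 + x ^ 2 := by positivity
    have h3 : 0 < (l + 2 * H) ^ 2 + x ^ 2 := by positivity
    rw [hdiff l hl, mul_div_assoc', div_le_div_iff₀ (by positivity) h2]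
    have h4 : 3 * H * (l + H) * x ≤ l * ((l + 2 * H) ^ 2 + x ^ 2) := by
      have h5 : 3 * H * (l + H) * x ≤ 2 * l * (l + 2 * H) * x :=
        mul_le_mul_of_nonneg_right (by nlinarith) hx
      nlinarith [mul_nonneg this.le (sq_nonneg (l + 2 * H - x))]
    nlinarith [mul_le_mul_of_nonneg_right h4 h2.le]
  have hBnn : 0 ≤ B := hB.nonneg fun k => by
    have hk := le_expRate h1 k
    have := hr k
    rw [hdiff _ hk]
    exact mul_nonneg (expCoeff_nonneg h0 h1 k) (by positivity)
  constructor
  · refine lt_of_lt_of_le ?_ (le_hasSum hA 0 fun k _ => ?_)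
    · simp only [expCoeff, expRate]
      positivity
    · exact mul_nonneg (expCoeff_nonneg h0 h1 k) (div_nonneg (hr k).le (by positivity))
  · rw [abs_of_nonneg hBnn]
    refine hasSum_le (fun k => ?_) hB (hA.mul_left (4 / 3))
    rw [mul_left_comm]
    exact mul_le_mul_of_nonneg_left (hle _ (le_expRate h1 k)) (expCoeff_nonneg h0 h1 k)

/-- Abel-type bound for a weighted sum of weights with controlled partial sums. -/
theorem sum_mul_le_of_partial_sums {p g : ℕ → ℝ} {M T G : ℝ} (n : ℕ) (hp : ∀ i, 0 ≤ p i)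
    (hM : ∀ N, ∑ i ∈ Finset.range N, p i ≤ M) (hT : ∑ i ∈ Finset.range n, p i ≤ M - T)
    (hg : ∀ i, g i ≤ g 0) (hG : ∀ i, n ≤ i → g i ≤ G) (hG0 : 0 ≤ G) (hGg : G ≤ g 0)
    (N : ℕ) (hN : n ≤ N) :
    ∑ i ∈ Finset.range N, p i * g i ≤ M * g 0 - T * (g 0 - G) := by
  rw [← Finset.sum_range_add_sum_Ico _ hN]
  have h1 : ∑ i ∈ Finset.range n, p i * g i ≤ (∑ i ∈ Finset.range n, p i) * g 0 := by
    rw [Finset.sum_mul]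
    exact Finset.sum_le_sum fun i _ => mul_le_mul_of_nonneg_left (hg i) (hp i)
  have h2 : ∑ i ∈ Finset.Ico n N, p i * g i ≤ (∑ i ∈ Finset.Ico n N, p i) * G := by
    rw [Finset.sum_mul]
    exact Finset.sum_le_sum fun i hi =>
      mul_le_mul_of_nonneg_left (hG i (Finset.mem_Ico.1 hi).1) (hp i)
  have h3 := hM N
  rw [← Finset.sum_range_add_sum_Ico _ hN] at h3
  nlinarith [mul_le_mul_of_nonneg_right h3 hG0, mul_le_mul_of_nonneg_right hT (sub_nonneg.2 hGg)]

theorem sum_weight_rate {H : ℝ} (h0 : 1 / 2 < H) (n : ℕ) :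
    ∑ i ∈ Finset.range n, (i + 2 - H) * -expCoeff H (i + 2) =
      H + 2 * H * (1 - H) - (n + 2) * (2 * n + 3 - 2 * H) * -expCoeff H (n + 2) /
        (2 * (2 * H - 1)) := by
  have h1 := sum_expCoeff_succ H (n + 1)
  have h2 := sum_mul_expCoeff_add_two H n
  rw [Finset.sum_range_succ'] at h1
  have h3 : (2 * H - 1) ≠ 0 := by linarith
  simp only [zero_add, expCoeff_one] at h1
  have e : ∑ i ∈ Finset.range n, (i + 2 - H) * -expCoeff H (i + 2) =
      ∑ i ∈ Finset.range n, (i + 2) * -expCoeff H (i + 2) +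
        H * ∑ i ∈ Finset.range n, expCoeff H (i + 2) := by
    rw [Finset.mul_sum, ← Finset.sum_add_distrib]
    exact Finset.sum_congr rfl fun i _ => by ring
  rw [e]
  refine mul_left_cancel₀ h3 ?_
  push_cast at h1
  have h4 : (2 * H - 1) * ((n + 2) * (2 * n + 3 - 2 * H) * -expCoeff H (n + 2) /
      (2 * (2 * H - 1))) = (n + 2) * (2 * n + 3 - 2 * H) * -expCoeff H (n + 2) / 2 := by
    field_simp
  rw [mul_sub, h4]
  linear_combination h2 + (2 * H - 1) / 2 * h1

theorem expCoeff_tail_lower_bound {H : ℝ} (h0 : 1 / 2 < H) (h1 : H < 1) (n : ℕ) :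
    4 * H * (1 - H) * (2 * H - 1) ≤ (n + 3) * (n + 2) * (n + 1) * -expCoeff H (n + 3) := by
  induction n with
  | zero =>
    simp [expCoeff]
    apply le_of_eq
    ring
  | succ n ih =>
    have h2 := expCoeff_add_two_mul H (n + 2)
    have h3 := expCoeff_add_two_nonpos h0 h1 (n + 1)
    push_cast at h2 ⊢
    have h4 : 0 ≤ ((n : ℝ) + 3) * (n + 2) * (2 - 2 * H) * -expCoeff H (n + 3) :=
      mul_nonneg (mul_nonneg (by positivity) (by linarith)) (neg_nonneg.2 h3)
    have h5 : ((n : ℝ) + 1 + 3) * (n + 1 + 2) * (n + 1 + 1) * -expCoeff H (n + 1 + 3) =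
        (n + 3) * (n + 2) * (n + 1) * -expCoeff H (n + 3) +
          (n + 3) * (n + 2) * (2 - 2 * H) * -expCoeff H (n + 3) := by
      linear_combination -((n : ℝ) + 3) * (n + 2) * h2
    rw [h5]
    linarith

theorem sin_transform_bounds_of_half_lt {H x B : ℝ} (h0 : 1 / 2 < H) (h1 : H < 1) (hx : 0 ≤ x)
    (hB : HasSum (fun k => expCoeff H k *
      (x / (expRate H k ^ 2 + x ^ 2) - x / ((expRate H k + 2 * H) ^ 2 + x ^ 2))) B) :
    0 ≤ B ∧ B ≤ 8 * H ^ 2 * x * (1 / ((H ^ 2 + x ^ 2) * ((3 * H) ^ 2 + x ^ 2)) +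
      1 / (((1 - H) ^ 2 + x ^ 2) * ((1 + H) ^ 2 + x ^ 2))) := by
  set q : ℕ → ℝ := fun i => 1 / (((i + 2 - H) ^ 2 + x ^ 2) * ((i + 2 + H) ^ 2 + x ^ 2)) with hq
  have hp : 0 < H ^ 2 + x ^ 2 := by positivity
  have hp3 : 0 < (3 * H) ^ 2 + x ^ 2 := by positivity
  have hr : 0 < (1 - H) ^ 2 + x ^ 2 := by have : 0 < 1 - H := by linarith
                                          positivity
  have hs : 0 < (1 + H) ^ 2 + x ^ 2 := by positivity
  have hterm : ∀ i : ℕ, expCoeff H (i + 2) * (x / (expRate H (i + 2) ^ 2 + x ^ 2) -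
      x / ((expRate H (i + 2) + 2 * H) ^ 2 + x ^ 2)) =
      -(4 * H * x) * ((i + 2) * -expCoeff H (i + 2) * q i) := fun i => by
    have hi : (0 : ℝ) ≤ i := i.cast_nonneg
    have hi2 : (0 : ℝ) < i + 2 - H := by linarith
    have e1 : expRate H (i + 2) = i + 2 - H := by simp only [expRate]; push_cast; ring
    have e2 : (i : ℝ) + 2 - H + 2 * H = i + 2 + H := by ring
    have h2 : 0 < ((i : ℝ) + 2 - H) ^ 2 + x ^ 2 := by positivity
    have h3 : 0 < ((i : ℝ) + 2 + H) ^ 2 + x ^ 2 := by positivity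
    rw [e1, e2, hq]
    field_simp
    ring
  have hshift := (hasSum_nat_add_iff' 2).2 hB
  simp only [hterm, Finset.sum_range_succ, Finset.sum_range_zero, zero_add] at hshift
  have hhead : expCoeff H 0 * (x / (expRate H 0 ^ 2 + x ^ 2) -
        x / ((expRate H 0 + 2 * H) ^ 2 + x ^ 2)) + expCoeff H 1 *
        (x / (expRate H 1 ^ 2 + x ^ 2) - x / ((expRate H 1 + 2 * H) ^ 2 + x ^ 2)) =
      8 * H ^ 2 * x * (1 / ((H ^ 2 + x ^ 2) * ((3 * H) ^ 2 + x ^ 2)) +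
      1 / (((1 - H) ^ 2 + x ^ 2) * ((1 + H) ^ 2 + x ^ 2))) := by
    have e1 : H + 2 * H = 3 * H := by ring
    have e2 : 1 - H + 2 * H = 1 + H := by ring
    simp only [expCoeff_zero, expCoeff_one, expRate_zero, expRate_one, e1, e2]
    field_simp
    ring
  rw [hhead] at hshift
  have hw : ∀ i : ℕ, 0 ≤ ((i : ℝ) + 2) * -expCoeff H (i + 2) := fun i =>
    mul_nonneg (by positivity) (neg_nonneg.2 (expCoeff_add_two_nonpos h0 h1 i))
  have hqnn : ∀ i, 0 ≤ q i := fun i => by simp only [hq]; positivity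
  have hq0 : ∀ i, q i ≤ q 0 := fun i => by
    have hi : (0 : ℝ) ≤ i := i.cast_nonneg
    have hH2 : 0 < 2 - H := by linarith
    simp only [hq, CharP.cast_eq_zero, zero_add]
    gcongr <;> linarith
  have hq1 : q 0 ≤ 1 / (((1 - H) ^ 2 + x ^ 2) * ((1 + H) ^ 2 + x ^ 2)) := by
    simp only [hq, CharP.cast_eq_zero, zero_add]
    gcongr <;> linarith
  have hM : ∀ N : ℕ, ∑ i ∈ Finset.range N, ((i : ℝ) + 2) * -expCoeff H (i + 2) ≤ 2 * H :=
    fun N => by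
      have := sum_mul_expCoeff_add_two H N
      have h2 : 0 ≤ ((N : ℝ) + 2) * (N + 1) * -expCoeff H (N + 2) :=
        mul_nonneg (by positivity) (neg_nonneg.2 (expCoeff_add_two_nonpos h0 h1 N))
      have h3 : 0 < 2 * H - 1 := by linarith
      nlinarith
  have hlow : -(4 * H * x) * (2 * H * q 0) ≤ B - 8 * H ^ 2 * x *
      (1 / ((H ^ 2 + x ^ 2) * ((3 * H) ^ 2 + x ^ 2)) +
        1 / (((1 - H) ^ 2 + x ^ 2) * ((1 + H) ^ 2 + x ^ 2))) := by
    refine ge_of_tendsto' hshift.tendsto_sum_nat fun N => ?_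
    rw [← Finset.mul_sum]
    have := sum_mul_le_of_partial_sums (T := 0) (M := 2 * H) 0 hw hM (by simp; linarith) hq0
      (fun i _ => hq0 i) (hqnn 0) le_rfl N (Nat.zero_le N)
    rw [zero_mul, sub_zero] at this
    exact mul_le_mul_of_nonpos_left this (neg_nonpos.2 (by positivity))
  have hup := hshift.nonpos fun i =>
    mul_nonpos_of_nonpos_of_nonneg (neg_nonpos.2 (by positivity)) (mul_nonneg (hw i) (hqnn i))
  refine ⟨?_, by linarith⟩
  have h2 : 8 * H ^ 2 * x * q 0 ≤ 8 * H ^ 2 * x *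
      (1 / (((1 - H) ^ 2 + x ^ 2) * ((1 + H) ^ 2 + x ^ 2))) :=
    mul_le_mul_of_nonneg_left hq1 (by positivity)
  have h3 : 0 ≤ 8 * H ^ 2 * x * (1 / ((H ^ 2 + x ^ 2) * ((3 * H) ^ 2 + x ^ 2))) := by positivity
  linarith

/-- Lower bound for the cosine transform; the parameters `n` and `G` allow to trade the
contribution of the fast exponentials. -/
theorem cos_transform_lower_bound {H x A G : ℝ} (h0 : 1 / 2 < H) (h1 : H < 1)
    (hA : HasSum (fun k => expCoeff H k * (expRate H k / (expRate H k ^ 2 + x ^ 2))) A)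
    (n : ℕ) (hG : 1 / ((n + 2 - H) ^ 2 + x ^ 2) ≤ G) (hG0 : G ≤ 1 / ((2 - H) ^ 2 + x ^ 2)) :
    H / (H ^ 2 + x ^ 2) + 2 * H * (1 - H) / ((1 - H) ^ 2 + x ^ 2) -
      (H + 2 * H * (1 - H)) / ((2 - H) ^ 2 + x ^ 2) +
      (n + 2) * (2 * n + 3 - 2 * H) * -expCoeff H (n + 2) / (2 * (2 * H - 1)) *
        (1 / ((2 - H) ^ 2 + x ^ 2) - G) ≤ A := by
  set g : ℕ → ℝ := fun i => 1 / ((i + 2 - H) ^ 2 + x ^ 2) with hg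
  have hH2 : 0 < 2 - H := by linarith
  have hterm : ∀ i : ℕ, expCoeff H (i + 2) * (expRate H (i + 2) / (expRate H (i + 2) ^ 2 + x ^ 2)) =
      -((i + 2 - H) * -expCoeff H (i + 2) * g i) := fun i => by
    have e1 : expRate H (i + 2) = i + 2 - H := by simp only [expRate]; push_cast; ring
    rw [e1, hg]
    ring
  have hshift := (hasSum_nat_add_iff' 2).2 hA
  simp only [hterm, Finset.sum_range_succ, Finset.sum_range_zero, zero_add, expCoeff_zero,
    expCoeff_one, expRate_zero, expRate_one] at hshift
  have hT : ∀ N : ℕ, 0 ≤ ((N : ℝ) + 2) * (2 * N + 3 - 2 * H) * -expCoeff H (N + 2) /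
      (2 * (2 * H - 1)) := fun N => by
    have : (0 : ℝ) ≤ N := N.cast_nonneg
    exact div_nonneg (mul_nonneg (mul_nonneg (by linarith) (by linarith))
      (neg_nonneg.2 (expCoeff_add_two_nonpos h0 h1 N))) (by linarith)
  have hanti : ∀ i j : ℕ, i ≤ j → g j ≤ g i := fun i j hij => by
    have hi : (0 : ℝ) ≤ i := i.cast_nonneg
    have hi2 : (0 : ℝ) < i + 2 - H := by linarith
    have hj : (i : ℝ) ≤ j := by exact_mod_cast hij
    simp only [hg]
    gcongr
  have hlow : -((H + 2 * H * (1 - H)) * g 0 - (n + 2) * (2 * n + 3 - 2 * H) *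
      -expCoeff H (n + 2) / (2 * (2 * H - 1)) * (g 0 - G)) ≤
      A - (1 * (H / (H ^ 2 + x ^ 2)) +
        2 * H * ((1 - H) / ((1 - H) ^ 2 + x ^ 2))) := by
    refine ge_of_tendsto hshift.tendsto_sum_nat ?_
    filter_upwards [Filter.eventually_ge_atTop n] with N hN
    have key := sum_mul_le_of_partial_sums (g := g) (G := G)
      (p := fun i : ℕ => ((i : ℝ) + 2 - H) * -expCoeff H (i + 2)) n
      (fun i => mul_nonneg (by have : (0 : ℝ) ≤ i := i.cast_nonneg
                               linarith)
        (neg_nonneg.2 (expCoeff_add_two_nonpos h0 h1 i)))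
      (fun N => by rw [sum_weight_rate h0 N]; exact sub_le_self _ (hT N))
      (sum_weight_rate h0 n).le (fun i => hanti 0 i (Nat.zero_le i))
      (fun i hi => (hanti n i hi).trans hG)
      (le_trans (by positivity) hG) (by simpa [hg] using hG0) N hN
    rw [Finset.sum_neg_distrib]
    exact neg_le_neg key
  simp only [hg, CharP.cast_eq_zero, zero_add] at hlow
  refine le_trans (le_of_eq ?_) (sub_le_sub_right hlow
    (-(1 * (H / (H ^ 2 + x ^ 2)) + 2 * H * ((1 - H) / ((1 - H) ^ 2 + x ^ 2)))) |>.trans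
      (by linarith))
  ring

theorem cos_main_part_lower_bound {H x : ℝ} (h0 : 1 / 2 < H) (h1 : H < 1) :
    2 * H * (1 - H) * (1 / ((H ^ 2 + x ^ 2) * ((3 * H) ^ 2 + x ^ 2)) +
      1 / (((1 - H) ^ 2 + x ^ 2) * ((1 + H) ^ 2 + x ^ 2))) ≤
      H / (H ^ 2 + x ^ 2) + 2 * H * (1 - H) / ((1 - H) ^ 2 + x ^ 2) -
      (H + 2 * H * (1 - H)) / ((2 - H) ^ 2 + x ^ 2) := by
  have hH : 0 < H := by linarith
  have hH1 : 0 < 1 - H := by linarith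
  have hH2 : 0 < 2 - H := by linarith
  have e : H / (H ^ 2 + x ^ 2) + 2 * H * (1 - H) / ((1 - H) ^ 2 + x ^ 2) -
      (H + 2 * H * (1 - H)) / ((2 - H) ^ 2 + x ^ 2) =
      2 * H * (1 - H) * (2 * (1 / ((H ^ 2 + x ^ 2) * ((2 - H) ^ 2 + x ^ 2))) +
        (3 - 2 * H) * (1 / (((1 - H) ^ 2 + x ^ 2) * ((2 - H) ^ 2 + x ^ 2)))) := by
    have hp : 0 < H ^ 2 + x ^ 2 := by positivity
    have hr : 0 < (1 - H) ^ 2 + x ^ 2 := by positivity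
    have ht : 0 < (2 - H) ^ 2 + x ^ 2 := by positivity
    field_simp
    ring
  rw [e]
  have i1 : 1 / ((H ^ 2 + x ^ 2) * ((3 * H) ^ 2 + x ^ 2)) ≤
      1 / ((H ^ 2 + x ^ 2) * ((2 - H) ^ 2 + x ^ 2)) := by
    gcongr
    linarith
  have i2 : 1 / (((1 - H) ^ 2 + x ^ 2) * ((1 + H) ^ 2 + x ^ 2)) ≤
      1 / (((1 - H) ^ 2 + x ^ 2) * ((2 - H) ^ 2 + x ^ 2)) := by
    gcongr
    linarith
  have j1 : 0 < 1 / ((H ^ 2 + x ^ 2) * ((2 - H) ^ 2 + x ^ 2)) := by positivity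
  have j2 : 0 < 1 / (((1 - H) ^ 2 + x ^ 2) * ((2 - H) ^ 2 + x ^ 2)) := by positivity
  refine mul_le_mul_of_nonneg_left ?_ (by positivity)
  have j3 := mul_pos (by linarith : 0 < 2 - 2 * H) j2
  linarith

theorem expCoeff_tail_weight_lower_bound {H x : ℝ} (h0 : 1 / 2 < H) (h1 : H < 1) {n : ℕ}
    (hn : (n : ℝ) + 1 ≤ x) :
    4 * H * (1 - H) * ((x + 1) / ((x + 2) * x)) ≤
      (((n + 1 : ℕ) : ℝ) + 2) * (2 * ((n + 1 : ℕ) : ℝ) + 3 - 2 * H) *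
        -expCoeff H (n + 1 + 2) / (2 * (2 * H - 1)) := by
  have hnn : (0 : ℝ) ≤ n := n.cast_nonneg
  have hx0 : 0 < x := by linarith
  have h2 := expCoeff_tail_lower_bound h0 h1 n
  have h3 : 0 < 2 * H - 1 := by linarith
  have hH1 : 0 < 1 - H := by linarith
  have hw : 0 ≤ -expCoeff H (n + 3) := neg_nonneg.2 (expCoeff_add_two_nonpos h0 h1 (n + 1))
  change _ ≤ (((n + 1 : ℕ) : ℝ) + 2) * (2 * ((n + 1 : ℕ) : ℝ) + 3 - 2 * H) *
        -expCoeff H (n + 3) / (2 * (2 * H - 1))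
  generalize -expCoeff H (n + 3) = w at h2 hw ⊢
  have h4 : 4 * H * (1 - H) * ((2 * n + 3) / (2 * (n + 1) * (n + 2))) ≤
      (((n + 1 : ℕ) : ℝ) + 2) * (2 * ((n + 1 : ℕ) : ℝ) + 3 - 2 * H) * w / (2 * (2 * H - 1)) := by
    rw [mul_div_assoc', div_le_div_iff₀ (by positivity) (by positivity)]
    push_cast
    have h5 := mul_le_mul_of_nonneg_right h2 (by positivity : (0 : ℝ) ≤ 2 * (2 * n + 3))
    have h6 : 0 ≤ ((n : ℝ) + 3) * (n + 2) * (n + 1) * w * (1 - H) := by positivity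
    linarith
  refine le_trans (mul_le_mul_of_nonneg_left ?_ (by positivity)) h4
  rw [div_le_div_iff₀ (by positivity) (by positivity)]
  have h5 := mul_nonneg (by positivity : 0 ≤ ((n : ℝ) + 1) * x) (sub_nonneg.2 hn)
  have h6 := mul_nonneg (by positivity : 0 ≤ (n : ℝ) + 1) (sub_nonneg.2 hn)
  have h7 := mul_nonneg hx0.le hx0.le
  have h8 := mul_nonneg hnn hx0.le
  linarith

theorem rational_tail_bound {x : ℝ} (hx : 2 ≤ x) :
    (x - 2) * (2 / x ^ 4) ≤
      4 * ((x + 1) / ((x + 2) * x)) * ((x ^ 2 - 9 / 4) / (2 * x ^ 2 * (x ^ 2 + 9 / 4))) := by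
  have hx0 : 0 < x := by linarith
  have e : 4 * ((x + 1) / ((x + 2) * x)) * ((x ^ 2 - 9 / 4) / (2 * x ^ 2 * (x ^ 2 + 9 / 4))) -
      (x - 2) * (2 / x ^ 4) = 2 * (x ^ 3 - x ^ 2 / 2 - 9 / 4 * x + 9) /
        (x ^ 4 * (x + 2) * (x ^ 2 + 9 / 4)) := by
    field_simp
    ring
  have h2 : 0 ≤ x ^ 3 - x ^ 2 / 2 - 9 / 4 * x + 9 := by
    nlinarith [mul_nonneg hx0.le (sq_nonneg (x - 2)), sq_nonneg (x - 2)]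
  have h3 : 0 ≤ 2 * (x ^ 3 - x ^ 2 / 2 - 9 / 4 * x + 9) /
      (x ^ 4 * (x + 2) * (x ^ 2 + 9 / 4)) := by positivity
  linarith

theorem tail_bound_of_two_le {H x T : ℝ} (h0 : 1 / 2 < H) (h1 : H < 1) (hx : 2 ≤ x)
    (hT : 4 * H * (1 - H) * ((x + 1) / ((x + 2) * x)) ≤ T) :
    H * (1 - H) * ((x - 2) * (1 / ((H ^ 2 + x ^ 2) * ((3 * H) ^ 2 + x ^ 2)) +
      1 / (((1 - H) ^ 2 + x ^ 2) * ((1 + H) ^ 2 + x ^ 2)))) ≤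
      T * (1 / ((2 - H) ^ 2 + x ^ 2) - 1 / (x ^ 2 + x ^ 2)) := by
  have hH : 0 < H := by linarith
  have hH1 : 0 < 1 - H := by linarith
  have hx0 : 0 < x := by linarith
  have hx2 : 0 ≤ x - 2 := by linarith
  have hxx : 0 < x ^ 2 - 9 / 4 := by nlinarith
  have hg : (x ^ 2 - 9 / 4) / (2 * x ^ 2 * (x ^ 2 + 9 / 4)) ≤
      1 / ((2 - H) ^ 2 + x ^ 2) - 1 / (x ^ 2 + x ^ 2) := by
    have e : (x ^ 2 - 9 / 4) / (2 * x ^ 2 * (x ^ 2 + 9 / 4)) =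
        1 / (9 / 4 + x ^ 2) - 1 / (x ^ 2 + x ^ 2) := by
      field_simp
      ring
    have h2 : (2 - H) ^ 2 ≤ 9 / 4 := by nlinarith
    rw [e]
    gcongr
  have hE : 1 / ((H ^ 2 + x ^ 2) * ((3 * H) ^ 2 + x ^ 2)) +
      1 / (((1 - H) ^ 2 + x ^ 2) * ((1 + H) ^ 2 + x ^ 2)) ≤ 2 / x ^ 4 := by
    have i1 : 1 / ((H ^ 2 + x ^ 2) * ((3 * H) ^ 2 + x ^ 2)) ≤ 1 / (x ^ 2 * x ^ 2) := by
      gcongr <;> exact le_add_of_nonneg_left (sq_nonneg _)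
    have i2 : 1 / (((1 - H) ^ 2 + x ^ 2) * ((1 + H) ^ 2 + x ^ 2)) ≤ 1 / (x ^ 2 * x ^ 2) := by
      gcongr <;> exact le_add_of_nonneg_left (sq_nonneg _)
    have e : 2 / x ^ 4 = 1 / (x ^ 2 * x ^ 2) + 1 / (x ^ 2 * x ^ 2) := by ring
    rw [e]
    exact add_le_add i1 i2
  have hHH : 0 ≤ H * (1 - H) := by positivity
  calc _ ≤ H * (1 - H) * ((x - 2) * (2 / x ^ 4)) :=
        mul_le_mul_of_nonneg_left (mul_le_mul_of_nonneg_left hE hx2) hHH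
    _ ≤ H * (1 - H) * (4 * ((x + 1) / ((x + 2) * x)) *
        ((x ^ 2 - 9 / 4) / (2 * x ^ 2 * (x ^ 2 + 9 / 4)))) :=
        mul_le_mul_of_nonneg_left (rational_tail_bound hx) hHH
    _ = 4 * H * (1 - H) * ((x + 1) / ((x + 2) * x)) *
        ((x ^ 2 - 9 / 4) / (2 * x ^ 2 * (x ^ 2 + 9 / 4))) := by ring
    _ ≤ _ := mul_le_mul hT hg (by positivity) (le_trans (by positivity) hT)

/-- The comparison of the two transforms when the mixture has negative weights. -/
theorem transform_comparison_of_half_lt {H x A B : ℝ} (h0 : 1 / 2 < H) (h1 : H < 1) (hx : 0 ≤ x)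
    (hA : HasSum (fun k => expCoeff H k * (expRate H k / (expRate H k ^ 2 + x ^ 2))) A)
    (hB : HasSum (fun k => expCoeff H k *
      (x / (expRate H k ^ 2 + x ^ 2) - x / ((expRate H k + 2 * H) ^ 2 + x ^ 2))) B) :
    0 < A ∧ (1 - H) * |B| ≤ 8 * H * A := by
  obtain ⟨hB0, hB1⟩ := sin_transform_bounds_of_half_lt h0 h1 hx hB
  have hH : 0 < H := by linarith
  have hH1 : 0 < 1 - H := by linarith
  have hH2 : 0 < 2 - H := by linarith
  have hmain := cos_main_part_lower_bound (x := x) h0 h1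
  have hEpos : 0 < 1 / ((H ^ 2 + x ^ 2) * ((3 * H) ^ 2 + x ^ 2)) +
      1 / (((1 - H) ^ 2 + x ^ 2) * ((1 + H) ^ 2 + x ^ 2)) := by positivity
  have htail := fun T => tail_bound_of_two_le (x := x) (T := T) h0 h1
  generalize 1 / ((H ^ 2 + x ^ 2) * ((3 * H) ^ 2 + x ^ 2)) +
      1 / (((1 - H) ^ 2 + x ^ 2) * ((1 + H) ^ 2 + x ^ 2)) = E at hB1 hmain hEpos htail
  have hA0 : 2 * H * (1 - H) * E ≤ A := by
    have := cos_transform_lower_bound h0 h1 hA 0 (G := 1 / ((2 - H) ^ 2 + x ^ 2)) (by simp) le_rfl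
    rw [sub_self, mul_zero, add_zero] at this
    exact hmain.trans this
  refine ⟨lt_of_lt_of_le (by positivity) hA0, ?_⟩
  rw [abs_of_nonneg hB0]
  suffices h : H * (1 - H) * x * E ≤ A by
    have h2 := mul_le_mul_of_nonneg_left hB1 hH1.le
    have h3 := mul_le_mul_of_nonneg_left h (by positivity : 0 ≤ 8 * H)
    linarith
  rcases le_total x 2 with hx2 | hx2
  · have : H * (1 - H) * x * E ≤ H * (1 - H) * 2 * E := by gcongr
    linarith
  obtain ⟨n, hn⟩ : ∃ n : ℕ, ⌊x⌋₊ = n + 1 :=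
    ⟨⌊x⌋₊ - 1, by have : 0 < ⌊x⌋₊ := Nat.floor_pos.2 (by linarith)
                  omega⟩
  have hn1 : (n : ℝ) + 1 ≤ x := by
    have := Nat.floor_le hx
    rw [hn] at this
    exact_mod_cast this
  have hn2 : x < n + 2 := by
    have := Nat.lt_floor_add_one x
    rw [hn] at this
    push_cast at this
    linarith
  have hx0 : 0 < x := by linarith
  have hxn : x ≤ ((n + 1 : ℕ) : ℝ) + 2 - H := by push_cast; linarith
  have hG : 1 / ((((n + 1 : ℕ) : ℝ) + 2 - H) ^ 2 + x ^ 2) ≤ 1 / (x ^ 2 + x ^ 2) := by gcongr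
  have hG0 : 1 / (x ^ 2 + x ^ 2) ≤ 1 / ((2 - H) ^ 2 + x ^ 2) := by gcongr; linarith
  have hbound := cos_transform_lower_bound h0 h1 hA (n + 1) hG hG0
  have ht := htail _ hx2 (expCoeff_tail_weight_lower_bound h0 h1 hn1)
  have e : H * (1 - H) * x * E = 2 * H * (1 - H) * E + H * (1 - H) * ((x - 2) * E) := by ring
  rw [e]
  exact (add_le_add hmain ht).trans hbound

theorem tanh_le_self {x : ℝ} (hx : 0 ≤ x) : tanh x ≤ x := by
  have hmono : MonotoneOn (fun y => y * cosh y - sinh y) (Set.Ici 0) := by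
    refine monotoneOn_of_deriv_nonneg (convex_Ici 0) (by fun_prop) (by fun_prop) fun y hy => ?_
    rw [interior_Ici] at hy
    have : HasDerivAt (fun y => y * cosh y - sinh y) (1 * cosh y + y * sinh y - cosh y) y :=
      ((hasDerivAt_id y).mul (hasDerivAt_cosh y)).sub (hasDerivAt_sinh y)
    rw [this.deriv]
    have := mul_nonneg (le_of_lt hy) (sinh_nonneg_iff.2 (le_of_lt hy))
    linarith
  have := hmono Set.self_mem_Ici hx hx
  simp only [zero_mul, sinh_zero, sub_zero] at this
  rw [tanh_eq_sinh_div_cosh, div_le_iff₀ (cosh_pos x)]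
  linarith

theorem one_le_Gamma_of_le_one {s : ℝ} (h0 : 0 < s) (h1 : s ≤ 1) : 1 ≤ Gamma s := by
  have := Gamma_strictAntiOn_Ioc.antitoneOn ⟨h0, h1⟩ ⟨one_pos, le_rfl⟩ h1
  rwa [Gamma_one] at this

theorem Gamma_le_one_of_mem_Icc {s : ℝ} (h1 : 1 ≤ s) (h2 : s ≤ 2) : Gamma s ≤ 1 := by
  have := convexOn_Gamma.le_max_of_mem_Icc (x := 1) (y := 2) (z := s)
    (by simp) (by simp) ⟨h1, h2⟩
  simpa [Gamma_one, Gamma_two] using this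

/-- If `√|θ| < (Γ(2H)/Γ(H)²)((1 − H)/(4H)) sin(πH) tanh(πH)`, then
the cosine transform `a` dominates `(√|θ|/2)·|b|` everywhere. -/
theorem cosine_dominates_sine_transform (H : ℝ) (hH : H ∈ Set.Ioo (0:ℝ) 1)
    (a b : ℝ → ℝ)
    (ha : ∀ x : ℝ, a x = ∫ v in Set.Ioi (0:ℝ), Ffun H v * Real.cos (x * v))
    (hb : ∀ x : ℝ, b x = ∫ v in Set.Ioi (0:ℝ),
      Ffun H v * (1 - Real.exp (-(2 * H * v))) * Real.sin (x * v))
    (θ : ℝ)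
    (hθ : Real.sqrt |θ| < (Real.Gamma (2 * H) / Real.Gamma H ^ 2)
      * ((1 - H) / (4 * H)) * Real.sin (π * H) * Real.tanh (π * H)) :
    ∀ x : ℝ, a x > (Real.sqrt |θ| / 2) * |b x| := by
  obtain ⟨h0, h1⟩ := hH
  have hpi := pi_pos
  have hG := one_le_Gamma_of_le_one h0 h1.le
  have hsin0 : 0 ≤ sin (π * H) := sin_nonneg_of_nonneg_of_le_pi (by positivity) (by nlinarith)
  have htanh0 : 0 ≤ tanh (π * H) := by
    rw [tanh_eq_sinh_div_cosh]
    exact div_nonneg (sinh_nonneg_iff.2 (by positivity)) (cosh_pos _).le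
  have hG2 : 0 < Gamma (2 * H) := Gamma_pos_of_pos (by linarith)
  have hfrac : 0 ≤ (1 - H) / (4 * H) := div_nonneg (by linarith) (by linarith)
  have hGdiv : Gamma (2 * H) / Gamma H ^ 2 ≤ Gamma (2 * H) :=
    div_le_self hG2.le (one_le_pow₀ hG)
  have hGdiv0 : 0 ≤ Gamma (2 * H) / Gamma H ^ 2 := by positivity
  have hsq := sqrt_nonneg |θ|
  -- it suffices to treat nonnegative frequencies
  suffices hmain : ∀ x : ℝ, 0 ≤ x → a x > (Real.sqrt |θ| / 2) * |b x| by
    intro x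
    rcases le_total 0 x with hx | hx
    · exact hmain x hx
    · have hea : a (-x) = a x := by simp only [ha, neg_mul, cos_neg]
      have heb : b (-x) = -b x := by simp only [hb, neg_mul, sin_neg, mul_neg, integral_neg]
      have := hmain (-x) (by linarith)
      rwa [hea, heb, abs_neg] at this
  intro x hx
  have hA := hasSum_cos_transform ⟨h0, h1⟩ x
  have hB := hasSum_sin_transform ⟨h0, h1⟩ x
  rw [← ha] at hA
  rw [← hb] at hB
  rcases le_or_gt H (1 / 2) with h | h
  · obtain ⟨hpos, hle⟩ := transform_comparison_of_le_half h0 h hx hA hB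
    have hG3 : Gamma (2 * H) ≤ 1 / (2 * H) := by
      have := Gamma_le_one_of_mem_Icc (s := 2 * H + 1) (by linarith) (by linarith)
      rw [Gamma_add_one (by positivity)] at this
      rw [le_div_iff₀ (by positivity)]
      linarith
    have hθ' : √|θ| < 3 / 2 := by
      refine hθ.trans_le ?_
      have hg := hGdiv.trans hG3
      have hs : sin (π * H) ≤ π * H := sin_le (by positivity)
      have ht : tanh (π * H) ≤ π * H := tanh_le_self (by positivity)
      have hf : (1 - H) / (4 * H) ≤ 1 / (4 * H) := by gcongr; linarith
      calc _ ≤ (1 / (2 * H)) * (1 / (4 * H)) * (π * H) * (π * H) :=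
            mul_le_mul (mul_le_mul (mul_le_mul hg hf hfrac (by positivity)) hs hsin0
              (by positivity)) ht htanh0 (by positivity)
        _ = π ^ 2 / 8 := by field_simp; norm_num
        _ ≤ 3 / 2 := by nlinarith [pi_lt_d2]
    nlinarith [abs_nonneg (b x)]
  · obtain ⟨hpos, hle⟩ := transform_comparison_of_half_lt h h1 hx hA hB
    have hθ' : √|θ| < (1 - H) / (4 * H) := by
      refine hθ.trans_le ?_
      have hG3 := Gamma_le_one_of_mem_Icc (s := 2 * H) (by linarith) (by linarith)
      calc _ ≤ 1 * ((1 - H) / (4 * H)) * 1 * 1 := by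
            gcongr
            · exact hGdiv.trans hG3
            · exact sin_le_one _
            · exact (tanh_lt_one _).le
        _ = _ := by ring
    rw [lt_div_iff₀ (by positivity)] at hθ'
    have h2 := mul_le_mul_of_nonneg_left hle hsq
    have h3 := mul_lt_mul_of_pos_right hθ' hpos
    have h4 : 0 < 1 - H := by linarith
    have h5 : (1 - H) * (√|θ| / 2 * |b x|) < (1 - H) * a x := by linarith
    exact lt_of_mul_lt_mul_left h5 h4.le
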